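/- Let n10 be the 7-dimensional nilpotent real Lie algebra with basis e1,…,e7 and only nonzero brackets [e1,e2] = −e4, [e1,e3] = −e5, [e2,e3] = −e6 (up to antisymmetry). Then: (i) the space of closed alternating 4-forms on n10 has dimension 28; (ii) the 4-form ψ = (6/5)e^{1235}−(34/25)e^{1237}+e^{1256}+(12/25)e^{1257}+(8/5)e^{1345}+e^{1346}−(12/25)e^{1347}−(16/25)e^{1457}+2e^{2345}−(6/5)e^{2347}+e^{2467}−e^{3567} is closed and the only derivation of n10 stabilizing ψ is 0. -/

import Mathlib

noncomputable section

/-- The underlying 7-dimensional real vector space. -/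
abbrev V : Type := Fin 7 → ℝ

/-- The Lie bracket of the nilpotent Lie algebra `n₁₀` ([e1,e2] = -e4, [e1,e3] = -e5, [e2,e3] = -e6), extended bilinearly from the structure constants. -/
def bk (x y : V) : V :=
  ![0, 0, 0, -(x 0 * y 1 - x 1 * y 0), -(x 0 * y 2 - x 2 * y 0), -(x 1 * y 2 - x 2 * y 1), 0]

/-- The alternating 4-form `e^i ∧ e^j ∧ e^k ∧ e^l` on `V`. -/
def w4 (i j k l : Fin 7) : AlternatingMap ℝ V ℝ (Fin 4) :=
  (Matrix.detRowAlternating : AlternatingMap ℝ (Fin 4 → ℝ) ℝ (Fin 4)).compLinearMap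
    (LinearMap.pi (fun a => LinearMap.proj (![i, j, k, l] a)))

/-- Chevalley–Eilenberg differential of a 4-form, as a scalar-valued function. -/
def d4 (ψ : AlternatingMap ℝ V ℝ (Fin 4)) (x₀ x₁ x₂ x₃ x₄ : V) : ℝ :=
  -(ψ ![bk x₀ x₁, x₂, x₃, x₄]) + ψ ![bk x₀ x₂, x₁, x₃, x₄] - ψ ![bk x₀ x₃, x₁, x₂, x₄]
    + ψ ![bk x₀ x₄, x₁, x₂, x₃] - ψ ![bk x₁ x₂, x₀, x₃, x₄] + ψ ![bk x₁ x₃, x₀, x₂, x₄]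
    - ψ ![bk x₁ x₄, x₀, x₂, x₃] - ψ ![bk x₂ x₃, x₀, x₁, x₄] + ψ ![bk x₂ x₄, x₀, x₁, x₃]
    - ψ ![bk x₃ x₄, x₀, x₁, x₂]

/-- A 4-form is closed if its Chevalley–Eilenberg differential vanishes. -/
def Closed4 (ψ : AlternatingMap ℝ V ℝ (Fin 4)) : Prop :=
  ∀ x₀ x₁ x₂ x₃ x₄ : V, d4 ψ x₀ x₁ x₂ x₃ x₄ = 0

/-- A linear map `D : V → V` is a derivation of the Lie algebra `(V, bk)`. -/
def IsDeriv (D : V →ₗ[ℝ] V) : Prop :=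
  ∀ x y : V, D (bk x y) = bk (D x) y + bk x (D y)

/-- `D` stabilizes (annihilates infinitesimally) the 4-form `ψ`. -/
def Stab4 (ψ : AlternatingMap ℝ V ℝ (Fin 4)) (D : V →ₗ[ℝ] V) : Prop :=
  ∀ x y z w : V, ψ ![D x, y, z, w] + ψ ![x, D y, z, w] + ψ ![x, y, D z, w] + ψ ![x, y, z, D w] = 0

/-- The distinguished 4-form. -/
def psi : AlternatingMap ℝ V ℝ (Fin 4) :=
  ((6/5) : ℝ) • w4 0 1 2 4 - ((34/25) : ℝ) • w4 0 1 2 6 + w4 0 1 4 5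
    + ((12/25) : ℝ) • w4 0 1 4 6 + ((8/5) : ℝ) • w4 0 2 3 4 + w4 0 2 3 5
    - ((12/25) : ℝ) • w4 0 2 3 6 - ((16/25) : ℝ) • w4 0 3 4 6 + (2 : ℝ) • w4 1 2 3 4
    - ((6/5) : ℝ) • w4 1 2 3 6 + w4 1 3 5 6 - w4 2 4 5 6

/-- The standard basis vector `e i` of `V`. -/
def stdVec (i : Fin 7) : V := Pi.single i 1

lemma stdVec_apply (i j : Fin 7) : stdVec i j = if j = i then 1 else 0 := by
  simp [stdVec, Pi.single_apply]

lemma w4_apply_eq_det (i j k l : Fin 7) (v : Fin 4 → V) :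
    w4 i j k l v = (Matrix.of fun r s => v r (![i, j, k, l] s)).det := rfl

lemma w4_apply (i j k l : Fin 7) (x y z w : V) :
    w4 i j k l ![x, y, z, w] =
      x i * (y j * (z k * w l - z l * w k) - y k * (z j * w l - z l * w j)
        + y l * (z j * w k - z k * w j))
      - x j * (y i * (z k * w l - z l * w k) - y k * (z i * w l - z l * w i)
        + y l * (z i * w k - z k * w i))
      + x k * (y i * (z j * w l - z l * w j) - y j * (z i * w l - z l * w i)
        + y l * (z i * w j - z j * w i))
      - x l * (y i * (z j * w k - z k * w j) - y j * (z i * w k - z k * w i)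
        + y k * (z i * w j - z j * w i)) := by
  rw [w4_apply_eq_det]
  simp [Matrix.det_succ_row_zero, Fin.sum_univ_succ, Fin.succAbove]
  ring

lemma w4_stdVec {i j k l a b c d : Fin 7} (hij : i < j) (hjk : j < k) (hkl : k < l)
    (hab : a < b) (hbc : b < c) (hcd : c < d) :
    w4 i j k l ![stdVec a, stdVec b, stdVec c, stdVec d] =
      if i = a ∧ j = b ∧ k = c ∧ l = d then 1 else 0 := by
  rw [w4_apply_eq_det]
  split_ifs with h
  · obtain ⟨rfl, rfl, rfl, rfl⟩ := h
    convert Matrix.det_one (n := Fin 4) (R := ℝ) using 2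
    ext r s
    have hik := hij.trans hjk
    have hjl := hjk.trans hkl
    have hil := hik.trans hkl
    fin_cases r <;> fin_cases s <;>
      simp [stdVec_apply, hij.ne, hij.ne', hjk.ne, hjk.ne', hkl.ne, hkl.ne', hik.ne, hik.ne',
        hjl.ne, hjl.ne', hil.ne, hil.ne']
  · have hrow : ∃ r : Fin 4, ∀ s : Fin 4, ![i, j, k, l] s ≠ ![a, b, c, d] r := by
      by_contra! hc
      obtain ⟨s0, h0⟩ := hc 0
      obtain ⟨s1, h1⟩ := hc 1
      obtain ⟨s2, h2⟩ := hc 2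
      obtain ⟨s3, h3⟩ := hc 3
      fin_cases s0 <;> fin_cases s1 <;> fin_cases s2 <;> fin_cases s3 <;>
        simp at h0 h1 h2 h3 <;> omega
    obtain ⟨r, hr⟩ := hrow
    refine Matrix.det_eq_zero_of_row_eq_zero r fun s => ?_
    have := hr s
    fin_cases r <;> simpa [stdVec_apply] using this

/-- The value of a 4-form on a quadruple of standard basis vectors, as a linear form. -/
def coeff (a b c d : Fin 7) : AlternatingMap ℝ V ℝ (Fin 4) →ₗ[ℝ] ℝ where
  toFun ψ := ψ ![stdVec a, stdVec b, stdVec c, stdVec d]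
  map_add' _ _ := rfl
  map_smul' _ _ := rfl

lemma alternating_ext {φ ψ : AlternatingMap ℝ V ℝ (Fin 4)}
    (h : ∀ a b c d : Fin 7, a < b → b < c → c < d →
      coeff a b c d φ = coeff a b c d ψ) :
    φ = ψ := by
  apply (exteriorPower.alternatingMapLinearEquiv (R := ℝ) (M := V) (N := ℝ) (n := 4)).injective
  refine ((Pi.basisFun ℝ (Fin 7)).exteriorPower 4).ext fun s => ?_
  rw [exteriorPower.basis_apply, exteriorPower.ιMulti_family]
  simp only [exteriorPower.alternatingMapLinearEquiv_apply_ιMulti]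
  set f := Set.powersetCard.ofFinEmbEquiv.symm s
  have hf : ((Pi.basisFun ℝ (Fin 7)) ∘ f : Fin 4 → V) =
      ![stdVec (f 0), stdVec (f 1), stdVec (f 2), stdVec (f 3)] := by
    funext r
    fin_cases r <;> simp [stdVec]
  rw [hf]
  exact h _ _ _ _ (f.strictMono (by decide)) (f.strictMono (by decide)) (f.strictMono (by decide))

lemma finrank_alternating : Module.finrank ℝ (AlternatingMap ℝ V ℝ (Fin 4)) = 35 := by
  rw [(exteriorPower.alternatingMapLinearEquiv (R := ℝ) (M := V) (N := ℝ) (n := 4)).finrank_eq,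
    Module.finrank_linearMap_self, exteriorPower.finrank_eq]
  simp
  decide

lemma bk_stdVec_zero_one : bk (stdVec 0) (stdVec 1) = -stdVec 3 := by
  ext i; fin_cases i <;> simp [bk, stdVec_apply]

lemma bk_stdVec_zero_two : bk (stdVec 0) (stdVec 2) = -stdVec 4 := by
  ext i; fin_cases i <;> simp [bk, stdVec_apply]

lemma bk_stdVec_one_two : bk (stdVec 1) (stdVec 2) = -stdVec 5 := by
  ext i; fin_cases i <;> simp [bk, stdVec_apply]

lemma bk_stdVec_right {j : Fin 7} (hj : 3 ≤ j) (x : V) : bk x (stdVec j) = 0 := by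
  have h0 : (0 : Fin 7) ≠ j := by omega
  have h1 : (1 : Fin 7) ≠ j := by omega
  have h2 : (2 : Fin 7) ≠ j := by omega
  ext i; fin_cases i <;> simp [bk, stdVec_apply, h0, h1, h2]

section AlternatingFour

variable (ψ : AlternatingMap ℝ V ℝ (Fin 4)) (x y z w : V)

lemma map_neg_first : ψ ![-x, y, z, w] = -ψ ![x, y, z, w] := by
  have h : ![-x, y, z, w] = Function.update ![x, y, z, w] 0 (-x) := by
    ext i : 1
    fin_cases i <;> rfl
  rw [h, ψ.map_update_neg]
  congr 2
  exact Function.update_eq_self 0 ![x, y, z, w]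

lemma map_zero_first : ψ ![0, y, z, w] = 0 :=
  ψ.map_coord_zero 0 rfl

lemma map_move_one : ψ ![x, y, z, w] = -ψ ![y, x, z, w] := by
  rw [← ψ.map_swap ![y, x, z, w] (show (0 : Fin 4) ≠ 1 by decide)]
  congr 1
  ext i : 1
  fin_cases i <;> rfl

lemma map_move_two : ψ ![x, y, z, w] = ψ ![y, z, x, w] := by
  rw [map_move_one, ← ψ.map_swap ![y, x, z, w] (show (1 : Fin 4) ≠ 2 by decide)]
  congr 1
  ext i : 1
  fin_cases i <;> rfl

lemma map_move_three : ψ ![x, y, z, w] = -ψ ![y, z, w, x] := by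
  rw [map_move_two, ← ψ.map_swap ![y, z, w, x] (show (2 : Fin 4) ≠ 3 by decide)]
  congr 1
  ext i : 1
  fin_cases i <;> rfl

lemma map_eq_third : ψ ![x, y, x, w] = 0 :=
  ψ.map_eq_zero_of_eq _ (i := 0) (j := 2) rfl (by decide)

lemma map_eq_fourth : ψ ![x, y, z, x] = 0 :=
  ψ.map_eq_zero_of_eq _ (i := 0) (j := 3) rfl (by decide)

end AlternatingFour

lemma d4_stdVec_zero_one_two (ψ : AlternatingMap ℝ V ℝ (Fin 4)) {k l : Fin 7}
    (hk : 3 ≤ k) (hl : 3 ≤ l) :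
    d4 ψ (stdVec 0) (stdVec 1) (stdVec 2) (stdVec k) (stdVec l) =
      ψ ![stdVec 3, stdVec 2, stdVec k, stdVec l] - ψ ![stdVec 4, stdVec 1, stdVec k, stdVec l]
        + ψ ![stdVec 5, stdVec 0, stdVec k, stdVec l] := by
  simp only [d4, bk_stdVec_zero_one, bk_stdVec_zero_two, bk_stdVec_one_two, bk_stdVec_right hk,
    bk_stdVec_right hl, map_neg_first, map_zero_first]
  ring

/-- The linear forms on 4-forms which cut out the closed ones. -/
def obstruction : AlternatingMap ℝ V ℝ (Fin 4) →ₗ[ℝ] (Fin 7 → ℝ) :=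
  LinearMap.pi ![coeff 0 3 4 5, coeff 1 3 4 5, coeff 2 3 4 5, coeff 3 4 5 6,
    coeff 0 3 5 6 - coeff 1 3 4 6, coeff 0 4 5 6 - coeff 2 3 4 6, coeff 1 4 5 6 - coeff 2 3 5 6]

lemma obstruction_apply (ψ : AlternatingMap ℝ V ℝ (Fin 4)) :
    obstruction ψ = ![coeff 0 3 4 5 ψ, coeff 1 3 4 5 ψ, coeff 2 3 4 5 ψ, coeff 3 4 5 6 ψ,
      coeff 0 3 5 6 ψ - coeff 1 3 4 6 ψ, coeff 0 4 5 6 ψ - coeff 2 3 4 6 ψ,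
      coeff 1 4 5 6 ψ - coeff 2 3 5 6 ψ] := by
  ext i; fin_cases i <;> rfl

lemma Closed4.obstruction_eq_zero {ψ : AlternatingMap ℝ V ℝ (Fin 4)} (h : Closed4 ψ) :
    obstruction ψ = 0 := by
  have key {k l : Fin 7} (hk : 3 ≤ k) (hl : 3 ≤ l) :=
    (d4_stdVec_zero_one_two ψ hk hl).symm.trans (h _ _ _ _ _)
  have h34 := key (k := 3) (l := 4) (by decide) (by decide)
  have h35 := key (k := 3) (l := 5) (by decide) (by decide)
  have h45 := key (k := 4) (l := 5) (by decide) (by decide)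
  have h36 := key (k := 3) (l := 6) (by decide) (by decide)
  have h46 := key (k := 4) (l := 6) (by decide) (by decide)
  have h56 := key (k := 5) (l := 6) (by decide) (by decide)
  have h456 := h (stdVec 0) (stdVec 1) (stdVec 4) (stdVec 5) (stdVec 6)
  simp only [map_eq_third, map_eq_fourth] at h34 h35 h45 h36 h46 h56
  rw [map_move_three] at h34
  rw [map_move_two] at h35
  rw [map_move_one] at h45
  rw [map_move_two ψ (stdVec 4), map_move_two ψ (stdVec 5)] at h36
  rw [map_move_one ψ (stdVec 3), map_move_two ψ (stdVec 5)] at h46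
  rw [map_move_one ψ (stdVec 3), map_move_one ψ (stdVec 4)] at h56
  simp only [d4, bk_stdVec_zero_one, bk_stdVec_right (show (3 : Fin 7) ≤ 4 by decide),
    bk_stdVec_right (show (3 : Fin 7) ≤ 5 by decide),
    bk_stdVec_right (show (3 : Fin 7) ≤ 6 by decide), map_neg_first, map_zero_first] at h456
  rw [obstruction_apply]
  ext i
  fin_cases i <;> simp [coeff] <;> linarith

/-- The closed 4-forms, as a subspace. -/
def closedForms : Submodule ℝ (AlternatingMap ℝ V ℝ (Fin 4)) where
  carrier := {ψ | Closed4 ψ}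
  zero_mem' _ _ _ _ _ := by simp [d4]
  add_mem' {φ ψ} hφ hψ x₀ x₁ x₂ x₃ x₄ := by
    have h₁ := hφ x₀ x₁ x₂ x₃ x₄
    have h₂ := hψ x₀ x₁ x₂ x₃ x₄
    simp only [d4, AlternatingMap.add_apply] at h₁ h₂ ⊢
    linear_combination h₁ + h₂
  smul_mem' r ψ hψ x₀ x₁ x₂ x₃ x₄ := by
    have h := hψ x₀ x₁ x₂ x₃ x₄
    simp only [d4, AlternatingMap.smul_apply, smul_eq_mul] at h ⊢
    linear_combination r * h

/-- The increasing quadruples `i < j < k < l` for which `w4 i j k l` is closed. -/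
def closedIndices : List (Fin 7 × Fin 7 × Fin 7 × Fin 7) :=
  [(0, 1, 2, 3), (0, 1, 2, 4), (0, 1, 2, 5), (0, 1, 2, 6), (0, 1, 3, 4), (0, 1, 3, 5),
    (0, 1, 3, 6), (0, 1, 4, 5), (0, 1, 4, 6), (0, 1, 5, 6), (0, 2, 3, 4), (0, 2, 3, 5),
    (0, 2, 3, 6), (0, 2, 4, 5), (0, 2, 4, 6), (0, 2, 5, 6), (0, 3, 4, 6), (1, 2, 3, 4),
    (1, 2, 3, 5), (1, 2, 3, 6), (1, 2, 4, 5), (1, 2, 4, 6), (1, 2, 5, 6), (1, 3, 5, 6),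
    (2, 4, 5, 6)]

/-- The increasing quadruples `i < j < k < l` for which `w4 i j k l` is not closed. -/
def nonclosedIndices : List (Fin 7 × Fin 7 × Fin 7 × Fin 7) :=
  [(0, 3, 4, 5), (1, 3, 4, 5), (2, 3, 4, 5), (3, 4, 5, 6), (0, 3, 5, 6), (1, 3, 4, 6),
    (0, 4, 5, 6), (2, 3, 4, 6), (1, 4, 5, 6), (2, 3, 5, 6)]

lemma w4_mem_closedForms :
    ∀ t ∈ closedIndices, w4 t.1 t.2.1 t.2.2.1 t.2.2.2 ∈ closedForms := by
  simp only [closedIndices, List.forall_mem_cons, List.not_mem_nil, IsEmpty.forall_iff,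
    implies_true, and_true]
  refine ⟨?_, ?_, ?_, ?_, ?_, ?_, ?_, ?_, ?_, ?_, ?_, ?_, ?_, ?_, ?_, ?_, ?_, ?_, ?_, ?_,
    ?_, ?_, ?_, ?_, ?_⟩ <;> intro x₀ x₁ x₂ x₃ x₄ <;>
    simp [d4, w4_apply, bk] <;> ring

lemma w4_add_w4_mem_closedForms_one : w4 0 3 5 6 + w4 1 3 4 6 ∈ closedForms := by
  intro x₀ x₁ x₂ x₃ x₄
  simp [d4, w4_apply, bk]
  ring

lemma w4_add_w4_mem_closedForms_two : w4 0 4 5 6 + w4 2 3 4 6 ∈ closedForms := by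
  intro x₀ x₁ x₂ x₃ x₄
  simp [d4, w4_apply, bk]
  ring

lemma w4_add_w4_mem_closedForms_three : w4 1 4 5 6 + w4 2 3 5 6 ∈ closedForms := by
  intro x₀ x₁ x₂ x₃ x₄
  simp [d4, w4_apply, bk]
  ring

lemma coeff_w4 {i j k l a b c d : Fin 7} (hw : i < j ∧ j < k ∧ k < l)
    (ha : a < b ∧ b < c ∧ c < d) :
    coeff a b c d (w4 i j k l) = if i = a ∧ j = b ∧ k = c ∧ l = d then 1 else 0 :=
  w4_stdVec hw.1 hw.2.1 hw.2.2 ha.1 ha.2.1 ha.2.2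

lemma eq_sum_coeff_smul_w4 (ψ : AlternatingMap ℝ V ℝ (Fin 4)) :
    ψ = ∑ t : Fin 7 × Fin 7 × Fin 7 × Fin 7 with t.1 < t.2.1 ∧ t.2.1 < t.2.2.1 ∧ t.2.2.1 < t.2.2.2,
      coeff t.1 t.2.1 t.2.2.1 t.2.2.2 ψ • w4 t.1 t.2.1 t.2.2.1 t.2.2.2 := by
  refine alternating_ext fun a b c d hab hbc hcd => ?_
  rw [map_sum, Finset.sum_eq_single (a, b, c, d)]
  · simp [coeff_w4, hab, hbc, hcd]
  · rintro ⟨i, j, k, l⟩ ht hne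
    rw [map_smul, coeff_w4 (by simpa using ht) ⟨hab, hbc, hcd⟩, if_neg (by simpa using hne),
      smul_zero]
  · simp [hab, hbc, hcd]

lemma increasing_mem_indices : ∀ i j k l : Fin 7, i < j → j < k → k < l →
    (i, j, k, l) ∈ closedIndices ∨ (i, j, k, l) ∈ nonclosedIndices := by
  decide

lemma mem_closedForms_of_coeff_eq_zero {ψ : AlternatingMap ℝ V ℝ (Fin 4)}
    (h : ∀ t ∈ nonclosedIndices, coeff t.1 t.2.1 t.2.2.1 t.2.2.2 ψ = 0) : ψ ∈ closedForms := by
  rw [eq_sum_coeff_smul_w4 ψ]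
  refine Submodule.sum_mem _ fun t ht => ?_
  obtain ⟨h₁, h₂, h₃⟩ := (Finset.mem_filter.mp ht).2
  rcases increasing_mem_indices _ _ _ _ h₁ h₂ h₃ with ht | ht
  · exact Submodule.smul_mem _ _ (w4_mem_closedForms _ ht)
  · rw [h _ ht, zero_smul]
    exact Submodule.zero_mem _

lemma mem_closedForms_of_obstruction_eq_zero {ψ : AlternatingMap ℝ V ℝ (Fin 4)}
    (h : obstruction ψ = 0) : ψ ∈ closedForms := by
  rw [obstruction_apply] at h
  simp only [Matrix.cons_eq_zero_iff, sub_eq_zero] at h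
  obtain ⟨h₀, h₁, h₂, h₃, h₄, h₅, h₆, -⟩ := h
  set θ := coeff 1 3 4 6 ψ • (w4 0 3 5 6 + w4 1 3 4 6)
    + coeff 2 3 4 6 ψ • (w4 0 4 5 6 + w4 2 3 4 6)
    + coeff 2 3 5 6 ψ • (w4 1 4 5 6 + w4 2 3 5 6) with hθ
  have hθ_mem : θ ∈ closedForms :=
    add_mem (add_mem (Submodule.smul_mem _ _ w4_add_w4_mem_closedForms_one)
      (Submodule.smul_mem _ _ w4_add_w4_mem_closedForms_two))
      (Submodule.smul_mem _ _ w4_add_w4_mem_closedForms_three)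
  rw [← sub_add_cancel ψ θ]
  refine add_mem (mem_closedForms_of_coeff_eq_zero ?_) hθ_mem
  simp [nonclosedIndices, hθ, coeff_w4, h₀, h₁, h₂, h₃, h₄, h₅, h₆]

lemma closedForms_eq_ker : closedForms = LinearMap.ker obstruction :=
  le_antisymm (fun _ h => Closed4.obstruction_eq_zero h)
    fun _ h => mem_closedForms_of_obstruction_eq_zero h

lemma obstruction_surjective : Function.Surjective obstruction := by
  intro c
  refine ⟨c 0 • w4 0 3 4 5 + c 1 • w4 1 3 4 5 + c 2 • w4 2 3 4 5 + c 3 • w4 3 4 5 6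
    + c 4 • w4 0 3 5 6 + c 5 • w4 0 4 5 6 + c 6 • w4 1 4 5 6, ?_⟩
  rw [obstruction_apply]
  ext i
  fin_cases i <;> simp [coeff_w4]

lemma finrank_closedForms : Module.finrank ℝ closedForms = 28 := by
  have : FiniteDimensional ℝ (AlternatingMap ℝ V ℝ (Fin 4)) :=
    Module.finite_of_finrank_pos (by rw [finrank_alternating]; norm_num)
  have h := obstruction.finrank_range_add_finrank_ker
  rw [LinearMap.range_eq_top.mpr obstruction_surjective, finrank_top, finrank_alternating,
    ← closedForms_eq_ker, Module.finrank_fin_fun] at h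
  omega

lemma closed4_psi : Closed4 psi := by
  intro x₀ x₁ x₂ x₃ x₄
  simp [d4, psi, w4_apply, bk]
  ring

lemma IsDeriv.apply_stdVec_three {D : V →ₗ[ℝ] V} (hD : IsDeriv D) : D (stdVec 3) =
    ![0, 0, 0, D (stdVec 0) 0 + D (stdVec 1) 1, D (stdVec 1) 2, -D (stdVec 0) 2, 0] := by
  have h := hD (stdVec 0) (stdVec 1)
  rw [bk_stdVec_zero_one, map_neg, neg_eq_iff_eq_neg] at h
  rw [h]
  clear h
  generalize D (stdVec 0) = x
  generalize D (stdVec 1) = y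
  ext i
  fin_cases i <;> simp [bk, stdVec_apply, add_comm]

lemma IsDeriv.apply_stdVec_four {D : V →ₗ[ℝ] V} (hD : IsDeriv D) : D (stdVec 4) =
    ![0, 0, 0, D (stdVec 2) 1, D (stdVec 0) 0 + D (stdVec 2) 2, D (stdVec 0) 1, 0] := by
  have h := hD (stdVec 0) (stdVec 2)
  rw [bk_stdVec_zero_two, map_neg, neg_eq_iff_eq_neg] at h
  rw [h]
  clear h
  generalize D (stdVec 0) = x
  generalize D (stdVec 2) = y
  ext i
  fin_cases i <;> simp [bk, stdVec_apply, add_comm]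

lemma IsDeriv.apply_stdVec_five {D : V →ₗ[ℝ] V} (hD : IsDeriv D) : D (stdVec 5) =
    ![0, 0, 0, -D (stdVec 2) 0, D (stdVec 1) 0, D (stdVec 1) 1 + D (stdVec 2) 2, 0] := by
  have h := hD (stdVec 1) (stdVec 2)
  rw [bk_stdVec_one_two, map_neg, neg_eq_iff_eq_neg] at h
  rw [h]
  clear h
  generalize D (stdVec 1) = x
  generalize D (stdVec 2) = y
  ext i
  fin_cases i <;> simp [bk, stdVec_apply, add_comm]

lemma IsDeriv.apply_stdVec_six {D : V →ₗ[ℝ] V} (hD : IsDeriv D) : D (stdVec 6) =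
    ![0, 0, 0, D (stdVec 6) 3, D (stdVec 6) 4, D (stdVec 6) 5, D (stdVec 6) 6] := by
  have h0 := hD (stdVec 0) (stdVec 6)
  have h1 := hD (stdVec 1) (stdVec 6)
  rw [bk_stdVec_right (by decide), bk_stdVec_right (by decide), map_zero, zero_add] at h0 h1
  have h60 : D (stdVec 6) 0 = 0 := by simpa [bk, stdVec_apply] using (congrFun h1 3).symm
  have h61 : D (stdVec 6) 1 = 0 := by simpa [bk, stdVec_apply] using (congrFun h0 3).symm
  have h62 : D (stdVec 6) 2 = 0 := by simpa [bk, stdVec_apply] using (congrFun h0 4).symm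
  ext i
  fin_cases i <;> simp [h60, h61, h62]

set_option maxHeartbeats 2000000 in
lemma IsDeriv.eq_zero_of_stab4_psi {D : V →ₗ[ℝ] V} (hD : IsDeriv D) (hS : Stab4 psi D) :
    D = 0 := by
  have h3 := hD.apply_stdVec_three
  have h4 := hD.apply_stdVec_four
  have h5 := hD.apply_stdVec_five
  have h6 := hD.apply_stdVec_six
  generalize D (stdVec 6) 3 = a at h6
  generalize D (stdVec 6) 4 = b at h6
  generalize D (stdVec 6) 5 = c at h6
  generalize D (stdVec 6) 6 = d at h6
  have s0356 := hS (stdVec 0) (stdVec 3) (stdVec 5) (stdVec 6)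
  have s0456 := hS (stdVec 0) (stdVec 4) (stdVec 5) (stdVec 6)
  have s1235 := hS (stdVec 1) (stdVec 2) (stdVec 3) (stdVec 5)
  have s1245 := hS (stdVec 1) (stdVec 2) (stdVec 4) (stdVec 5)
  have s1456 := hS (stdVec 1) (stdVec 4) (stdVec 5) (stdVec 6)
  have s0125 := hS (stdVec 0) (stdVec 1) (stdVec 2) (stdVec 5)
  have s0134 := hS (stdVec 0) (stdVec 1) (stdVec 3) (stdVec 4)
  have s0135 := hS (stdVec 0) (stdVec 1) (stdVec 3) (stdVec 5)
  have s0136 := hS (stdVec 0) (stdVec 1) (stdVec 3) (stdVec 6)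
  have s0145 := hS (stdVec 0) (stdVec 1) (stdVec 4) (stdVec 5)
  have s0156 := hS (stdVec 0) (stdVec 1) (stdVec 5) (stdVec 6)
  have s0245 := hS (stdVec 0) (stdVec 2) (stdVec 4) (stdVec 5)
  have s0246 := hS (stdVec 0) (stdVec 2) (stdVec 4) (stdVec 6)
  have s0256 := hS (stdVec 0) (stdVec 2) (stdVec 5) (stdVec 6)
  have s1256 := hS (stdVec 1) (stdVec 2) (stdVec 5) (stdVec 6)
  have s0235 := hS (stdVec 0) (stdVec 2) (stdVec 3) (stdVec 5)
  have s0346 := hS (stdVec 0) (stdVec 3) (stdVec 4) (stdVec 6)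
  have s1246 := hS (stdVec 1) (stdVec 2) (stdVec 4) (stdVec 6)
  have s1356 := hS (stdVec 1) (stdVec 3) (stdVec 5) (stdVec 6)
  have s2456 := hS (stdVec 2) (stdVec 4) (stdVec 5) (stdVec 6)
  have s0123 := hS (stdVec 0) (stdVec 1) (stdVec 2) (stdVec 3)
  have s0146 := hS (stdVec 0) (stdVec 1) (stdVec 4) (stdVec 6)
  have s0124 := hS (stdVec 0) (stdVec 1) (stdVec 2) (stdVec 4)
  have s1236 := hS (stdVec 1) (stdVec 2) (stdVec 3) (stdVec 6)
  have s0236 := hS (stdVec 0) (stdVec 2) (stdVec 3) (stdVec 6)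
  simp [psi, w4_apply, stdVec_apply, h3, h4, h5, h6] at s0356 s0456 s1235 s1245 s1456 s0125 s0134
  simp [psi, w4_apply, stdVec_apply, h3, h4, h5, h6] at s0135 s0136 s0145 s0156 s0245 s0246 s0256
  simp [psi, w4_apply, stdVec_apply, h3, h4, h5, h6] at s1256 s0235 s0346 s1246 s1356 s2456 s0123
  simp [psi, w4_apply, stdVec_apply, h3, h4, h6] at s0146 s0124 s1236 s0236
  have m01 : D (stdVec 1) 0 = 0 := by linarith
  have m10 : D (stdVec 0) 1 = 0 := by linarith
  have m62 : D (stdVec 2) 6 = 0 := by linarith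
  have m02 : D (stdVec 2) 0 = 0 := by linarith
  have m20 : D (stdVec 0) 2 = 0 := by linarith
  have m61 : D (stdVec 1) 6 = 0 := by linarith
  have m12 : D (stdVec 2) 1 = 0 := by linarith
  have m21 : D (stdVec 1) 2 = 0 := by linarith
  have m60 : D (stdVec 0) 6 = 0 := by linarith
  have m00 : D (stdVec 0) 0 = 0 := by linarith
  have m30 : D (stdVec 0) 3 = 0 := by linarith
  have m40 : D (stdVec 0) 4 = 0 := by linarith
  have m50 : D (stdVec 0) 5 = 0 := by linarith
  have m11 : D (stdVec 1) 1 = 0 := by linarith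
  have m31 : D (stdVec 1) 3 = 0 := by linarith
  have m41 : D (stdVec 1) 4 = 0 := by linarith
  have m51 : D (stdVec 1) 5 = 0 := by linarith
  have m22 : D (stdVec 2) 2 = 0 := by linarith
  have m32 : D (stdVec 2) 3 = 0 := by linarith
  have m42 : D (stdVec 2) 4 = 0 := by linarith
  have m52 : D (stdVec 2) 5 = 0 := by linarith
  have ha : a = 0 := by linarith
  have hb : b = 0 := by linarith
  have hc : c = 0 := by linarith
  have hd : d = 0 := by linarith
  have h0 : D (stdVec 0) = 0 := by ext i; fin_cases i <;> assumption
  have h1 : D (stdVec 1) = 0 := by ext i; fin_cases i <;> assumption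
  have h2 : D (stdVec 2) = 0 := by ext i; fin_cases i <;> assumption
  have hz : (![0, 0, 0, 0, 0, 0, 0] : V) = 0 := by ext i; fin_cases i <;> rfl
  refine (Pi.basisFun ℝ (Fin 7)).ext fun j => ?_
  rw [Pi.basisFun_apply, LinearMap.zero_apply]
  change D (stdVec j) = 0
  fin_cases j
  · exact h0
  · exact h1
  · exact h2
  · simpa [h0, h1, hz] using h3
  · simpa [h0, h2, hz] using h4
  · simpa [h1, h2, hz] using h5
  · simpa [ha, hb, hc, hd, hz] using h6

theorem statement_16 :
    (∃ Z : Submodule ℝ (AlternatingMap ℝ V ℝ (Fin 4)),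
      (∀ ψ, ψ ∈ Z ↔ Closed4 ψ) ∧ Module.finrank ℝ Z = 28) ∧
    Closed4 psi ∧
    (∀ D : V →ₗ[ℝ] V, IsDeriv D → Stab4 psi D → D = 0) := by
  exact ⟨⟨closedForms, fun _ => Iff.rfl, finrank_closedForms⟩, closed4_psi,
    fun _ hD hS => hD.eq_zero_of_stab4_psi hS⟩
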